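/- arXiv:2103.14707 — 2 statements merged into one kernel-verified Lean document; each statement's English description precedes it below -/
import Mathlib

section
/- Let k ≥ 1 and m ≥ 0. The quotient ring A⟨k⟩/(ζ̄_{m+1}, …, ζ̄_{m+k}) is finite-dimensional as an F₂-vector space and has Krull dimension zero. -/
open MvPolynomial

/-- The dual Steenrod algebra `A = F₂[ξ₁, ξ₂, …]`; the variable `X i` represents `ξ_{i+1}`. -/
noncomputable abbrev DualSteenrod : Type := MvPolynomial ℕ (ZMod 2)

/-- The conjugate classes, via Milnor's recursion
`ζ_n = ∑_{i=1}^{n} ξ_i^{2^{n−i}} ζ_{n−i}` (with `ζ_0 = 1`). -/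
noncomputable def zeta : ℕ → DualSteenrod
  | 0 => 1
  | (n+1) => ∑ i ∈ Finset.range (n+1), (X i) ^ (2^(n-i)) * zeta (n-i)
  decreasing_by omega

/-- The projection `A → A⟨k⟩ = F₂[ξ₁, …, ξ_k]`, killing `ξ_i` for `i > k`.
In `MvPolynomial (Fin k) (ZMod 2)`, the variable `X i` represents `ξ_{i+1}`. -/
noncomputable def proj (k : ℕ) :
    DualSteenrod →ₐ[ZMod 2] MvPolynomial (Fin k) (ZMod 2) :=
  aeval (fun i => if h : i < k then X (⟨i, h⟩ : Fin k) else 0)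

/-- `ζ̄_n`, the image of `ζ_n` in `A⟨k⟩`. -/
noncomputable def zetaBar (k n : ℕ) : MvPolynomial (Fin k) (ZMod 2) :=
  proj k (zeta n)

/-- If all conjugate classes from some point on vanish in a domain where the generators `x i`
are eventually zero, then all generators vanish. -/
theorem eq_zero_of_milnor_recursion {R : Type*} [CommRing R] [IsDomain R] {k m : ℕ}
    {x z : ℕ → R} (hz₀ : z 0 = 1)
    (hz : ∀ n, z (n + 1) = ∑ i ∈ Finset.range (n + 1), x i ^ 2 ^ (n - i) * z (n - i))
    (hx : ∀ i, k ≤ i → x i = 0) (hm : ∀ i < k, z (m + 1 + i) = 0) (i : ℕ) : x i = 0 := by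
  have hvan : ∀ n, m < n → z n = 0 := by
    intro n
    induction n using Nat.strong_induction_on with
    | _ n ih =>
      intro hn
      by_cases hnk : n < m + 1 + k
      · have h := hm (n - (m + 1)) (by omega)
        rwa [Nat.add_sub_cancel' hn] at h
      · obtain ⟨n, rfl⟩ : ∃ j, n = j + 1 := ⟨n - 1, by omega⟩
        rw [hz]
        refine Finset.sum_eq_zero fun i hi => ?_
        by_cases hik : i < k
        · rw [ih (n - i) (by omega) (by omega), mul_zero]
        · rw [hx i (by omega), zero_pow (by positivity), zero_mul]
  by_contra hi
  classical
  obtain ⟨s, hs, hs'⟩ : ∃ s, x s ≠ 0 ∧ ∀ j, s < j → x j = 0 := by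
    have hik : i ≤ k := by
      by_contra h
      exact hi (hx i (by omega))
    refine ⟨Nat.findGreatest (fun j => x j ≠ 0) k,
      Nat.findGreatest_spec (P := fun j => x j ≠ 0) hik hi, fun j hj => ?_⟩
    by_cases hjk : j ≤ k
    · simpa using Nat.findGreatest_is_greatest hj hjk
    · exact hx j (by omega)
  obtain ⟨t, ht, ht'⟩ : ∃ t, z t ≠ 0 ∧ ∀ j, t < j → z j = 0 := by
    refine ⟨Nat.findGreatest (fun j => z j ≠ 0) m,
      Nat.findGreatest_spec (P := fun j => z j ≠ 0) (Nat.zero_le m) (by simp [hz₀]),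
      fun j hj => ?_⟩
    by_cases hjm : j ≤ m
    · simpa using Nat.findGreatest_is_greatest hj hjm
    · exact hvan j (by omega)
  have h := hz (s + t)
  rw [ht' _ (by omega), Finset.sum_eq_single_of_mem s (by simp), Nat.add_sub_cancel_left] at h
  · exact mul_ne_zero (pow_ne_zero _ hs) ht h.symm
  · intro j _ hj
    rcases lt_or_gt_of_ne hj with hj | hj
    · rw [ht' (s + t - j) (by omega), mul_zero]
    · rw [hs' j hj, zero_pow (by positivity), zero_mul]

theorem zetaBar_zero (k : ℕ) : zetaBar k 0 = 1 := by
  simp [zetaBar, zeta]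

theorem zetaBar_succ (k n : ℕ) : zetaBar k (n + 1) =
    ∑ i ∈ Finset.range (n + 1), proj k (X i) ^ 2 ^ (n - i) * zetaBar k (n - i) := by
  simp only [zetaBar]
  rw [zeta]
  simp only [map_sum, map_mul, map_pow]

theorem proj_X_of_lt {k i : ℕ} (h : i < k) : proj k (X i) = X ⟨i, h⟩ := by
  simp [proj, h]

theorem proj_X_of_le {k i : ℕ} (h : k ≤ i) : proj k (X i) = 0 := by
  simp [proj, h]

theorem constantCoeff_zetaBar_succ (k n : ℕ) : constantCoeff (zetaBar k (n + 1)) = 0 := by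
  rw [zetaBar_succ, map_sum]
  refine Finset.sum_eq_zero fun i _ => ?_
  have h : constantCoeff (proj k (X i)) = 0 := by
    by_cases hik : i < k
    · rw [proj_X_of_lt hik, constantCoeff_X]
    · rw [proj_X_of_le (by omega), map_zero]
  rw [map_mul, map_pow, h, zero_pow (by positivity), zero_mul]

/-- A quotient of a polynomial ring in finitely many variables in which all variables are
nilpotent is a finite module. -/
theorem MvPolynomial.finite_quotient_of_X_mem_radical {σ R : Type*} [Finite σ] [CommRing R]
    {I : Ideal (MvPolynomial σ R)} (h : ∀ i, X i ∈ I.radical) :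
    Module.Finite R (MvPolynomial σ R ⧸ I) := by
  have hint : Algebra.IsIntegral R (MvPolynomial σ R ⧸ I) := by
    refine ⟨fun y => ?_⟩
    obtain ⟨p, rfl⟩ := Ideal.Quotient.mk_surjective y
    induction p using MvPolynomial.induction_on with
    | C a => exact isIntegral_algebraMap (R := R) (x := a)
    | add p q hp hq => rw [map_add]; exact hp.add hq
    | mul_X p i hp =>
      rw [map_mul]
      refine hp.mul ?_
      obtain ⟨n, hn⟩ := h i
      refine ⟨Polynomial.X ^ n, Polynomial.monic_X_pow n, ?_⟩
      rw [Polynomial.eval₂_X_pow, ← map_pow, Ideal.Quotient.eq_zero_iff_mem.mpr hn]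
  exact Algebra.IsIntegral.finite

/-- For `k ≥ 1` and `m ≥ 0`, the quotient
`A⟨k⟩/(ζ̄_{m+1}, …, ζ̄_{m+k})` is finite-dimensional over `F₂` and has
Krull dimension zero. -/
theorem quotient_zetaBar_finiteDimensional_krullDimZero (k m : ℕ) (hk : 1 ≤ k)
    (I : Ideal (MvPolynomial (Fin k) (ZMod 2)))
    (hI : I = Ideal.span (Set.range fun i : Fin k => zetaBar k (m + 1 + (i : ℕ)))) :
    FiniteDimensional (ZMod 2) (MvPolynomial (Fin k) (ZMod 2) ⧸ I) ∧
    ringKrullDim (MvPolynomial (Fin k) (ZMod 2) ⧸ I) = 0 := by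
  subst hI
  set I := Ideal.span (Set.range fun i : Fin k => zetaBar k (m + 1 + (i : ℕ))) with hI
  have hrad : ∀ i, X i ∈ I.radical := by
    intro i
    rw [Ideal.radical_eq_sInf, Submodule.mem_sInf]
    rintro P ⟨hIP, hP⟩
    have h := eq_zero_of_milnor_recursion (k := k) (m := m)
      (x := fun j => Ideal.Quotient.mk P (proj k (X j)))
      (z := fun j => Ideal.Quotient.mk P (zetaBar k j))
      (by simp [zetaBar_zero]) (fun n => by simp [zetaBar_succ])
      (fun j hj => by simp [proj_X_of_le hj])
      (fun j hj => Ideal.Quotient.eq_zero_iff_mem.mpr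
        (hIP (Ideal.subset_span ⟨⟨j, hj⟩, rfl⟩))) i
    rw [Ideal.Quotient.eq_zero_iff_mem, proj_X_of_lt i.isLt] at h
    exact h
  have hfin : FiniteDimensional (ZMod 2) (MvPolynomial (Fin k) (ZMod 2) ⧸ I) :=
    MvPolynomial.finite_quotient_of_X_mem_radical hrad
  have hle : I ≤ RingHom.ker (constantCoeff (σ := Fin k) (R := ZMod 2)) := by
    rw [hI, Ideal.span_le]
    rintro _ ⟨i, rfl⟩
    rw [SetLike.mem_coe, RingHom.mem_ker]
    beta_reduce
    rw [Nat.add_right_comm]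
    exact constantCoeff_zetaBar_succ k _
  have : Nontrivial (MvPolynomial (Fin k) (ZMod 2) ⧸ I) :=
    Ideal.Quotient.nontrivial_iff.mpr fun h => RingHom.ker_ne_top _ (top_le_iff.mp (h ▸ hle))
  have : IsArtinianRing (MvPolynomial (Fin k) (ZMod 2) ⧸ I) :=
    IsArtinianRing.of_finite (ZMod 2) _
  exact ⟨hfin, ringKrullDimZero_iff_ringKrullDim_eq_zero.mp inferInstance⟩
end

section
/- Let k ≥ 1 and m ≥ 0, let I be the ideal (ζ̄_{m+1}, …, ζ̄_{m+k}) of A⟨k⟩, and set δ = 2(2^m − 1)(2^k − 1). Then: (1) every weighted-homogeneous polynomial in A⟨k⟩ of weighted degree strictly greater than δ lies in I; and (2) the image in A⟨k⟩/I of the space of weighted-homogeneous polynomials of weighted degree δ is a one-dimensional F₂-vector space. -/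
open MvPolynomial

section GradedRegularity

variable {A : Type*} [CommRing A]

/-- The element `a` acts injectively on `A ⧸ L`. -/
def Ideal.IsRegularMod (L : Ideal A) (a : A) : Prop :=
  ∀ x, a * x ∈ L → x ∈ L

/-- The ideal generated by `L` and `r 0, …, r (n - 1)`. -/
def Ideal.adjoinSeq (L : Ideal A) (r : ℕ → A) : ℕ → Ideal A
  | 0 => L
  | n + 1 => Ideal.span {r n} ⊔ L.adjoinSeq r n

lemma Ideal.adjoinSeq_eq_sup_span (L : Ideal A) (r : ℕ → A) (n : ℕ) :
    L.adjoinSeq r n = L ⊔ Ideal.span (r '' Set.Iio n) := by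
  induction n with
  | zero => simp [Ideal.adjoinSeq]
  | succ n ih =>
    rw [Ideal.adjoinSeq, ih, ← Order.succ_eq_add_one, Order.Iio_succ_eq_insert, Set.image_insert_eq,
      Ideal.span_insert, sup_left_comm]

lemma Ideal.le_adjoinSeq (L : Ideal A) (r : ℕ → A) (n : ℕ) : L ≤ L.adjoinSeq r n := by
  rw [L.adjoinSeq_eq_sup_span]
  exact le_sup_left

lemma Ideal.mem_adjoinSeq (L : Ideal A) (r : ℕ → A) {i n : ℕ} (h : i < n) :
    r i ∈ L.adjoinSeq r n := by
  rw [L.adjoinSeq_eq_sup_span]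
  exact Ideal.mem_sup_right (Ideal.subset_span ⟨i, h, rfl⟩)

lemma Ideal.adjoinSeq_span_sup (L : Ideal A) (r : ℕ → A) (a : A) (n : ℕ) :
    (Ideal.span {a} ⊔ L).adjoinSeq r n = Ideal.span {a} ⊔ L.adjoinSeq r n := by
  simp only [Ideal.adjoinSeq_eq_sup_span, sup_assoc]

lemma Ideal.adjoinSeq_cons (L : Ideal A) (r : ℕ → A) (n : ℕ) :
    L.adjoinSeq r (n + 1) = Ideal.span {r 0} ⊔ L.adjoinSeq (fun i => r (i + 1)) n := by
  induction n with
  | zero => rfl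
  | succ n ih => rw [Ideal.adjoinSeq, ih, sup_left_comm, Ideal.adjoinSeq]

lemma Ideal.span_sup_congr {L : Ideal A} {a b : A} (h : a - b ∈ L) :
    Ideal.span {a} ⊔ L = Ideal.span {b} ⊔ L := by
  have key : ∀ a b : A, a - b ∈ L → Ideal.span {a} ⊔ L ≤ Ideal.span {b} ⊔ L := by
    intro a b h
    refine sup_le ((Ideal.span_singleton_le_iff_mem _).2 ?_) le_sup_right
    exact Ideal.mem_span_singleton_sup.2 ⟨1, a - b, h, by ring⟩
  exact le_antisymm (key a b h) (key b a (by simpa using L.neg_mem h))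

lemma Ideal.IsRegularMod.congr {L : Ideal A} {a b : A} (ha : L.IsRegularMod a)
    (h : b - a ∈ L) : L.IsRegularMod b := by
  intro x hx
  refine ha x ?_
  have := L.sub_mem hx (L.mul_mem_right x h)
  rwa [show b * x - (b - a) * x = a * x by ring] at this

lemma Ideal.IsRegularMod.mul {L : Ideal A} {a b : A} (ha : L.IsRegularMod a)
    (hb : L.IsRegularMod b) : L.IsRegularMod (a * b) :=
  fun x hx => hb x (ha _ (by rwa [← mul_assoc]))

lemma Ideal.IsRegularMod.pow {L : Ideal A} {a : A} (ha : L.IsRegularMod a) (n : ℕ) :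
    L.IsRegularMod (a ^ n) := by
  induction n with
  | zero => intro x hx; simpa using hx
  | succ n ih => rw [pow_succ]; exact ih.mul ha

/-- If `a` is regular modulo `L` and `b` is regular modulo `L + (a)`, then `a` is regular modulo
`L + (b)`. -/
lemma Ideal.IsRegularMod.swap {L : Ideal A} {a b : A} (ha : L.IsRegularMod a)
    (hab : (Ideal.span {a} ⊔ L).IsRegularMod b) :
    (Ideal.span {b} ⊔ L).IsRegularMod a := by
  intro x hx
  obtain ⟨y, l, hl, hy⟩ := Ideal.mem_span_singleton_sup.1 hx
  obtain ⟨z, l', hl', hz⟩ := Ideal.mem_span_singleton_sup.1 (hab y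
    (Ideal.mem_span_singleton_sup.2 ⟨x, -l, L.neg_mem hl, by linear_combination -hy⟩))
  refine Ideal.mem_span_singleton_sup.2 ⟨z, x - z * b, ha _ ?_, by ring⟩
  have : a * (x - z * b) = b * l' + l := by linear_combination -hy - b * hz
  rw [this]
  exact L.add_mem (L.mul_mem_left _ hl') hl

variable {σ : Type*} [SetLike σ A] [AddSubgroupClass σ A] (𝒜 : ℕ → σ) [GradedRing 𝒜]

lemma Ideal.IsHomogeneous.span_singleton_sup {L : Ideal A} (hL : L.IsHomogeneous 𝒜) {a : A} {e : ℕ}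
    (ha : a ∈ 𝒜 e) : (Ideal.span {a} ⊔ L).IsHomogeneous 𝒜 :=
  (Ideal.homogeneous_span 𝒜 _ fun x hx => ⟨e, by rwa [Set.mem_singleton_iff.1 hx]⟩).sup hL

lemma Ideal.IsHomogeneous.adjoinSeq {L : Ideal A} (hL : L.IsHomogeneous 𝒜) {r : ℕ → A} {e : ℕ → ℕ}
    (hr : ∀ i, r i ∈ 𝒜 (e i)) (n : ℕ) : (L.adjoinSeq r n).IsHomogeneous 𝒜 := by
  induction n with
  | zero => exact hL
  | succ n ih => exact ih.span_singleton_sup 𝒜 (hr n)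

/-- Krull intersection for homogeneous ideals of an `ℕ`-graded ring. -/
lemma Ideal.IsHomogeneous.mem_of_forall_pow {L : Ideal A} (hL : L.IsHomogeneous 𝒜) {a : A} {e : ℕ}
    (he : 0 < e) (ha : a ∈ 𝒜 e) {x : A} (hx : ∀ n, x ∈ Ideal.span {a ^ n} ⊔ L) : x ∈ L := by
  refine (Ideal.IsHomogeneous.mem_iff 𝒜 hL).2 fun d => ?_
  obtain ⟨y, l, hl, rfl⟩ := Ideal.mem_span_singleton_sup.1 (hx (d + 1))
  have hpow : a ^ (d + 1) ∈ 𝒜 ((d + 1) • e) := SetLike.pow_mem_graded (d + 1) ha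
  have hlt : ¬ (d + 1) • e ≤ d := by
    have : (d + 1) * 1 ≤ (d + 1) * e := Nat.mul_le_mul_left _ he
    rw [smul_eq_mul]; omega
  rw [mul_comm, DirectSum.decompose_add, DirectSum.add_apply, AddMemClass.coe_add,
    DirectSum.coe_decompose_mul_of_left_mem_of_not_le 𝒜 hpow hlt, zero_add]
  exact (Ideal.IsHomogeneous.mem_iff 𝒜 hL).1 hl d

/-- A homogeneous element of `L + (f)` is congruent modulo `L` to a homogeneous multiple of `f`. -/
lemma Ideal.IsHomogeneous.exists_sub_mul_mem {L : Ideal A} (hL : L.IsHomogeneous 𝒜) {f p : A}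
    {c e : ℕ} (hf : f ∈ 𝒜 e) (hp : p ∈ 𝒜 (c + e)) (h : p ∈ Ideal.span {f} ⊔ L) :
    ∃ q ∈ 𝒜 c, p - f * q ∈ L := by
  obtain ⟨q, l, hl, hq⟩ := Ideal.mem_span_singleton_sup.1 h
  refine ⟨DirectSum.decompose 𝒜 q c, SetLike.coe_mem _, ?_⟩
  have h1 := DirectSum.coe_decompose_mul_of_left_mem_of_le 𝒜 (b := q) hf (Nat.le_add_left e c)
  rw [Nat.add_sub_cancel] at h1
  have h2 : l = p - f * q := by rw [← hq]; ring
  have h3 := (Ideal.IsHomogeneous.mem_iff 𝒜 hL).1 hl (c + e)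
  rwa [h2, DirectSum.decompose_sub, DirectSum.sub_apply, AddSubgroupClass.coe_sub, h1,
    DirectSum.decompose_of_mem_same 𝒜 hp] at h3

/-- Iterated division by `f`, when every homogeneous element of degree `> D` lies in `L + (f)`. -/
lemma Ideal.IsHomogeneous.exists_sub_pow_mul_mem {L : Ideal A} (hL : L.IsHomogeneous 𝒜) {f : A}
    {D c e : ℕ} (hf : f ∈ 𝒜 e) (hD : ∀ d, D < d → ∀ p ∈ 𝒜 d, p ∈ Ideal.span {f} ⊔ L)
    (hc : D < c + e) (n : ℕ) {p : A} (hp : p ∈ 𝒜 (c + n * e)) :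
    ∃ q ∈ 𝒜 c, p - f ^ n * q ∈ L := by
  induction n generalizing p with
  | zero => exact ⟨p, by simpa using hp, by simp⟩
  | succ n ih =>
    have hp' : p ∈ 𝒜 ((c + n * e) + e) := by rwa [add_assoc, ← Nat.succ_mul]
    obtain ⟨q₁, hq₁, h₁⟩ := hL.exists_sub_mul_mem 𝒜 hf hp' (hD _ (by omega) p hp')
    obtain ⟨q, hq, h⟩ := ih hq₁
    refine ⟨q, hq, ?_⟩
    have := L.add_mem h₁ (L.mul_mem_left f h)
    rwa [show p - f * q₁ + f * (q₁ - f ^ n * q) = p - f ^ (n + 1) * q by ring] at this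

/-- If `a` is homogeneous of positive degree and regular modulo the homogeneous ideal `L`, an
element regular modulo `L + (a)` is already regular modulo `L`. -/
lemma Ideal.IsRegularMod.of_span_sup {L : Ideal A} (hL : L.IsHomogeneous 𝒜) {a b : A} {e : ℕ}
    (he : 0 < e) (ha : a ∈ 𝒜 e) (hreg : L.IsRegularMod a)
    (hab : (Ideal.span {a} ⊔ L).IsRegularMod b) : L.IsRegularMod b := by
  intro x hx
  refine hL.mem_of_forall_pow 𝒜 he ha fun n => ?_
  suffices h : ∃ y, b * y ∈ L ∧ x - y * a ^ n ∈ L by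
    obtain ⟨y, -, hy⟩ := h
    exact Ideal.mem_span_singleton_sup.2 ⟨y, _, hy, by ring⟩
  induction n with
  | zero => exact ⟨x, hx, by simp⟩
  | succ n ih =>
    obtain ⟨y, hby, hy⟩ := ih
    obtain ⟨z, l, hl, rfl⟩ := Ideal.mem_span_singleton_sup.1 (hab y (Ideal.mem_sup_right hby))
    refine ⟨z, hreg _ ?_, ?_⟩
    · have := L.sub_mem hby (L.mul_mem_left b hl)
      rwa [show b * (z * a + l) - b * l = a * (b * z) by ring] at this
    · have := L.add_mem hy (L.mul_mem_right (a ^ n) hl)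
      rwa [show x - (z * a + l) * a ^ n + l * a ^ n = x - z * a ^ (n + 1) by ring] at this

/-- A regular sequence `a, r 0, …, r (n - 1)` of homogeneous elements may be rotated to
`r 0, …, r (n - 1), a`. -/
lemma Ideal.IsRegularMod.rotate {L : Ideal A} (hL : L.IsHomogeneous 𝒜) {a : A} {e : ℕ}
    (he : 0 < e) (ha : a ∈ 𝒜 e) (hreg : L.IsRegularMod a) {r : ℕ → A} {d : ℕ → ℕ}
    (hr : ∀ i, r i ∈ 𝒜 (d i)) (n : ℕ)
    (h : ∀ j < n, (Ideal.span {a} ⊔ L.adjoinSeq r j).IsRegularMod (r j)) :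
    (L.adjoinSeq r n).IsRegularMod a ∧ ∀ j < n, (L.adjoinSeq r j).IsRegularMod (r j) := by
  induction n with
  | zero => exact ⟨hreg, by simp⟩
  | succ n ih =>
    obtain ⟨h₁, h₂⟩ := ih fun j hj => h j (by omega)
    have h₃ := Ideal.IsRegularMod.of_span_sup 𝒜 (hL.adjoinSeq 𝒜 hr n) he ha h₁ (h n (by omega))
    refine ⟨h₁.swap (h n (by omega)), fun j hj => ?_⟩
    rcases Nat.lt_succ_iff_lt_or_eq.1 hj with hj | rfl
    · exact h₂ j hj
    · exact h₃

end GradedRegularity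

section ConjugateClasses

open Finset.HasAntidiagonal (antidiagonal)

/-- The classes `ξ_n`, with `ξ_0 = 1`. -/
noncomputable def xi : ℕ → DualSteenrod
  | 0 => 1
  | n + 1 => X n

lemma zeta_zero : zeta 0 = 1 := by rw [zeta]

lemma zeta_succ (n : ℕ) :
    zeta (n + 1) = ∑ p ∈ antidiagonal n, zeta p.1 * X p.2 ^ 2 ^ p.1 := by
  rw [zeta, ← Finset.Nat.sum_antidiagonal_swap,
    Finset.Nat.sum_antidiagonal_eq_sum_range_succ_mk]
  simp [mul_comm]

lemma sum_zeta_mul_xi (n : ℕ) :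
    ∑ p ∈ antidiagonal (n + 1), zeta p.1 * xi p.2 ^ 2 ^ p.1 = 0 := by
  rw [Finset.Nat.sum_antidiagonal_succ']
  simp only [xi, one_pow, mul_one, ← zeta_succ]
  exact CharTwo.add_self_eq_zero _

lemma sum_xi_mul_zeta (n : ℕ) :
    ∑ p ∈ antidiagonal (n + 1), xi p.1 * zeta p.2 ^ 2 ^ p.1 = 0 := by
  induction n using Nat.strong_induction_on with
  | _ n ih =>
    have assoc : ∑ p ∈ antidiagonal (n + 1),
          (∑ q ∈ antidiagonal p.1, zeta q.1 * xi q.2 ^ 2 ^ q.1) * zeta p.2 ^ 2 ^ p.1 =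
        ∑ p ∈ antidiagonal (n + 1),
          zeta p.1 * (∑ q ∈ antidiagonal p.2, xi q.1 * zeta q.2 ^ 2 ^ q.1) ^ 2 ^ p.1 := by
      simp only [sum_pow_char_pow, Finset.sum_mul, Finset.mul_sum, Finset.sum_sigma', mul_pow,
        ← pow_mul]
      refine Finset.sum_nbij' (fun x ↦ ⟨(x.2.1, x.2.2 + x.1.2), (x.2.2, x.1.2)⟩)
        (fun x ↦ ⟨(x.1.1 + x.2.1, x.2.2), (x.1.1, x.2.1)⟩) ?_ ?_ ?_ ?_ ?_
      · rintro ⟨⟨i, j⟩, ⟨k, l⟩⟩ h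
        simp only [Finset.mem_sigma, Finset.HasAntidiagonal.mem_antidiagonal, and_true] at h ⊢
        omega
      · rintro ⟨⟨i, j⟩, ⟨k, l⟩⟩ h
        simp only [Finset.mem_sigma, Finset.HasAntidiagonal.mem_antidiagonal, and_true] at h ⊢
        omega
      · rintro ⟨⟨i, j⟩, ⟨k, l⟩⟩ h
        simp only [Finset.mem_sigma, Finset.HasAntidiagonal.mem_antidiagonal] at h
        obtain ⟨-, rfl⟩ := h
        rfl
      · rintro ⟨⟨i, j⟩, ⟨k, l⟩⟩ h
        simp only [Finset.mem_sigma, Finset.HasAntidiagonal.mem_antidiagonal] at h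
        obtain ⟨-, rfl⟩ := h
        rfl
      · rintro ⟨⟨i, j⟩, ⟨k, l⟩⟩ h
        simp only [Finset.mem_sigma, Finset.HasAntidiagonal.mem_antidiagonal] at h
        obtain ⟨-, rfl⟩ := h
        rw [mul_assoc, ← pow_add, add_comm l k]
    have left : ∑ p ∈ antidiagonal (n + 1),
          (∑ q ∈ antidiagonal p.1, zeta q.1 * xi q.2 ^ 2 ^ q.1) * zeta p.2 ^ 2 ^ p.1 =
        zeta (n + 1) := by
      rw [Finset.Nat.sum_antidiagonal_succ]
      simp only [sum_zeta_mul_xi, zero_mul, Finset.sum_const_zero, add_zero]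
      simp [xi, zeta_zero]
    have right : ∑ p ∈ antidiagonal n, zeta (p.1 + 1) *
          (∑ q ∈ antidiagonal p.2, xi q.1 * zeta q.2 ^ 2 ^ q.1) ^ 2 ^ (p.1 + 1) =
        zeta (n + 1) := by
      rw [Finset.sum_eq_single (n, 0)]
      · simp [xi, zeta_zero]
      · rintro ⟨i, j⟩ h hne
        rw [Finset.HasAntidiagonal.mem_antidiagonal] at h
        obtain _ | j := j
        · exact absurd (by simpa using h) hne
        · simp only at h ⊢
          rw [ih j (by omega), zero_pow (by positivity), mul_zero]
      · intro h
        exact absurd (by simp) h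
    rw [left, Finset.Nat.sum_antidiagonal_succ, right] at assoc
    simpa [zeta_zero] using assoc

lemma zeta_succ' (n : ℕ) :
    zeta (n + 1) = ∑ p ∈ antidiagonal n, X p.1 * zeta p.2 ^ 2 ^ (p.1 + 1) := by
  have h := sum_xi_mul_zeta n
  rw [Finset.Nat.sum_antidiagonal_succ] at h
  simp only [xi, one_mul, pow_zero, pow_one] at h
  exact CharTwo.add_eq_zero.1 h

end ConjugateClasses

section ZetaIdeal

attribute [local instance] MvPolynomial.weightedGradedAlgebra

open Finset.HasAntidiagonal (antidiagonal)

/-- The weight `2 ^ i - 1` of `ξ_i`. -/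
def xiWeight (i : ℕ) : ℕ := 2 ^ (i + 1) - 1

/-- The weight grading of the dual Steenrod algebra. -/
noncomputable abbrev steenrodGrading : ℕ → Submodule (ZMod 2) DualSteenrod :=
  weightedHomogeneousSubmodule (ZMod 2) xiWeight

/-- The ideal `(ξ_{k+1}, ξ_{k+2}, …)`. -/
noncomputable def tailIdeal (k : ℕ) : Ideal DualSteenrod :=
  Ideal.span (X '' Set.Ici k)

/-- The ideal `(ξ_{k+1}, ξ_{k+2}, …) + (ζ_{m+1}, …, ζ_{m+j})`. -/
noncomputable def zetaIdeal (k m j : ℕ) : Ideal DualSteenrod :=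
  (tailIdeal k).adjoinSeq (fun i => zeta (m + 1 + i)) j

lemma X_mem_steenrodGrading (i : ℕ) : (X i : DualSteenrod) ∈ steenrodGrading (xiWeight i) :=
  isWeightedHomogeneous_X _ _ _

lemma zeta_mem_steenrodGrading (n : ℕ) : zeta n ∈ steenrodGrading (2 ^ n - 1) := by
  induction n using Nat.strong_induction_on with
  | _ n ih =>
    cases n with
    | zero => rw [zeta_zero]; exact isWeightedHomogeneous_one _ _
    | succ n =>
      rw [zeta_succ]
      refine Submodule.sum_mem _ ?_
      rintro ⟨i, j⟩ h
      rw [Finset.HasAntidiagonal.mem_antidiagonal] at h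
      simp only at h ⊢
      subst h
      have hdeg : 2 ^ (i + j + 1) - 1 = (2 ^ i - 1) + 2 ^ i • xiWeight j := by
        have h₁ : 1 ≤ 2 ^ i := Nat.one_le_two_pow
        have h₂ : 2 ^ i * 1 ≤ 2 ^ i * 2 ^ (j + 1) := Nat.mul_le_mul_left _ Nat.one_le_two_pow
        rw [xiWeight, smul_eq_mul, Nat.mul_sub, add_assoc, pow_add]
        omega
      rw [hdeg]
      exact SetLike.mul_mem_graded (ih i (by omega))
        (SetLike.pow_mem_graded _ (X_mem_steenrodGrading j))

lemma tailIdeal_isHomogeneous (k : ℕ) : (tailIdeal k).IsHomogeneous steenrodGrading := by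
  refine Ideal.homogeneous_span _ _ ?_
  rintro _ ⟨i, -, rfl⟩
  exact ⟨_, X_mem_steenrodGrading i⟩

lemma zetaIdeal_isHomogeneous (k m j : ℕ) : (zetaIdeal k m j).IsHomogeneous steenrodGrading :=
  (tailIdeal_isHomogeneous k).adjoinSeq _ (fun _ => zeta_mem_steenrodGrading _) j

lemma X_mem_tailIdeal {i k : ℕ} (h : k ≤ i) : (X i : DualSteenrod) ∈ tailIdeal k :=
  Ideal.subset_span ⟨i, h, rfl⟩

lemma span_X_sup_tailIdeal (k : ℕ) : Ideal.span {X k} ⊔ tailIdeal (k + 1) = tailIdeal k := by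
  rw [tailIdeal, tailIdeal, ← Ideal.span_insert, ← Set.image_insert_eq]
  congr 2
  ext i
  simp only [Set.mem_insert_iff, Set.mem_Ici]
  omega

lemma tailIdeal_isRegularMod_X (k : ℕ) : (tailIdeal (k + 1)).IsRegularMod (X k) := by
  intro x hx
  rw [tailIdeal, mem_ideal_span_X_image] at hx ⊢
  intro d hd
  obtain ⟨i, hi, hne⟩ := hx (Finsupp.single k 1 + d) (by
    rwa [mem_support_iff, coeff_X_mul, ← mem_support_iff])
  refine ⟨i, hi, ?_⟩
  have : k ≠ i := by
    rintro rfl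
    simp at hi
  simpa [Finsupp.single_apply, this] using hne

lemma span_X_sup_zetaIdeal (k m j : ℕ) :
    Ideal.span {X k} ⊔ zetaIdeal (k + 1) m j = zetaIdeal k m j := by
  rw [zetaIdeal, ← Ideal.adjoinSeq_span_sup, span_X_sup_tailIdeal, zetaIdeal]

lemma span_zeta_sup_zetaIdeal (k m j : ℕ) :
    Ideal.span {zeta (m + 1)} ⊔ zetaIdeal k (m + 1) j = zetaIdeal k m (j + 1) := by
  rw [zetaIdeal, zetaIdeal, Ideal.adjoinSeq_cons]
  congr! 4 with i
  omega

/-- Modulo `ζ_{m+1}, …, ζ_{m+k}` and `ξ_{k+2}, ξ_{k+3}, …`, the class `ζ_{m+k+1}` agrees with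
`ζ_m ^ 2 ^ (k + 1) * ξ_{k+1}`. -/
lemma zeta_sub_mem_zetaIdeal (k m : ℕ) :
    zeta (m + 1 + k) - zeta m ^ 2 ^ (k + 1) * X k ∈ zetaIdeal (k + 1) m k := by
  have hmem : (k, m) ∈ antidiagonal (m + k) := by
    simp [add_comm]
  rw [add_right_comm, zeta_succ', ← Finset.add_sum_erase _ _ hmem, mul_comm, add_sub_cancel_left]
  refine Ideal.sum_mem _ ?_
  rintro ⟨i, j⟩ h
  rw [Finset.mem_erase, Finset.HasAntidiagonal.mem_antidiagonal, ne_eq, Prod.mk.injEq] at h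
  simp only at h ⊢
  by_cases hi : i < k
  · refine Ideal.mul_mem_left _ _ (Ideal.pow_mem_of_mem _ ?_ _ (by positivity))
    rw [show j = m + 1 + (k - 1 - i) by omega]
    exact Ideal.mem_adjoinSeq _ (fun i => zeta (m + 1 + i)) (by omega)
  · exact Ideal.mul_mem_right _ _ (Ideal.le_adjoinSeq _ _ _ (X_mem_tailIdeal (by omega)))

lemma zetaIdeal_succ_succ (k m : ℕ) :
    zetaIdeal (k + 1) m (k + 1) =
      Ideal.span {zeta m ^ 2 ^ (k + 1) * X k} ⊔ zetaIdeal (k + 1) m k :=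
  Ideal.span_sup_congr (zeta_sub_mem_zetaIdeal k m)

lemma zeta_zero_isRegularMod (L : Ideal DualSteenrod) : L.IsRegularMod (zeta 0) := by
  intro x hx
  rwa [zeta_zero, one_mul] at hx

/-- If `ζ_{m+1}, …, ζ_{m+k+1}` is regular, then so is `ζ_{m+2}, …, ζ_{m+k+1}, ζ_{m+1}`. -/
lemma zeta_isRegularMod_of_forall {k m : ℕ}
    (h : ∀ j < k + 1, (zetaIdeal (k + 1) m j).IsRegularMod (zeta (m + 1 + j))) :
    (zetaIdeal (k + 1) (m + 1) k).IsRegularMod (zeta (m + 1)) := by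
  refine (Ideal.IsRegularMod.rotate steenrodGrading (tailIdeal_isHomogeneous _)
    (Nat.sub_pos_of_lt (Nat.one_lt_two_pow m.succ_ne_zero)) (zeta_mem_steenrodGrading (m + 1))
    (h 0 k.succ_pos) (fun _ => zeta_mem_steenrodGrading _) k fun j hj => ?_).1
  have := h (j + 1) (by omega)
  rwa [← span_zeta_sup_zetaIdeal, show m + 1 + (j + 1) = m + 1 + 1 + j by omega] at this

/-- The classes `ζ_{m+1}, …, ζ_{m+k}` form a regular sequence modulo `ξ_{k+1}, ξ_{k+2}, …`. -/
theorem zetaIdeal_isRegularMod (k m : ℕ) :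
    ∀ j < k, (zetaIdeal k m j).IsRegularMod (zeta (m + 1 + j)) := by
  induction k generalizing m with
  | zero => simp
  | succ k ihk =>
    have step : ∀ m, (zetaIdeal (k + 1) m k).IsRegularMod (zeta m) →
        ∀ j < k + 1, (zetaIdeal (k + 1) m j).IsRegularMod (zeta (m + 1 + j)) := by
      intro m hm j hj
      have hX := Ideal.IsRegularMod.rotate steenrodGrading (tailIdeal_isHomogeneous (k + 1))
        (Nat.sub_pos_of_lt (Nat.one_lt_two_pow k.succ_ne_zero)) (X_mem_steenrodGrading k)
        (tailIdeal_isRegularMod_X k) (fun i => zeta_mem_steenrodGrading (m + 1 + i)) k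
        fun j hj => by
          have := ihk m j hj
          rwa [← span_X_sup_zetaIdeal] at this
      rcases Nat.lt_succ_iff_lt_or_eq.1 hj with hj | rfl
      · exact hX.2 j hj
      · exact ((hm.pow _).mul hX.1).congr (zeta_sub_mem_zetaIdeal j m)
    induction m with
    | zero => exact step 0 (zeta_zero_isRegularMod _)
    | succ m ihm => exact step (m + 1) (zeta_isRegularMod_of_forall ihm)

lemma zetaIdeal_isRegularMod_zeta (k m : ℕ) :
    (zetaIdeal (k + 1) m k).IsRegularMod (zeta m) := by
  cases m with
  | zero => exact zeta_zero_isRegularMod _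
  | succ m => exact zeta_isRegularMod_of_forall (zetaIdeal_isRegularMod (k + 1) m)

/-- The socle degree `2 (2 ^ m - 1) (2 ^ k - 1)`. -/
def socleDegree (k m : ℕ) : ℕ := 2 * (2 ^ m - 1) * (2 ^ k - 1)

lemma socleDegree_succ (k m : ℕ) :
    socleDegree (k + 1) m = socleDegree k m + 2 ^ (k + 1) * (2 ^ m - 1) := by
  obtain ⟨b, hb⟩ : ∃ b, 2 ^ k = b + 1 := ⟨2 ^ k - 1, (Nat.sub_add_cancel Nat.one_le_two_pow).symm⟩
  rw [socleDegree, socleDegree, pow_succ, hb, Nat.add_sub_cancel,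
    show (b + 1) * 2 - 1 = 2 * b + 1 by omega]
  ring

lemma socleDegree_lt (k m : ℕ) :
    socleDegree (k + 1) m < socleDegree k (m + 1) + (2 ^ (m + 1) - 1) := by
  obtain ⟨a, ha⟩ : ∃ a, 2 ^ m = a + 1 := ⟨2 ^ m - 1, (Nat.sub_add_cancel Nat.one_le_two_pow).symm⟩
  obtain ⟨b, hb⟩ : ∃ b, 2 ^ k = b + 1 := ⟨2 ^ k - 1, (Nat.sub_add_cancel Nat.one_le_two_pow).symm⟩
  rw [socleDegree, socleDegree, pow_succ, pow_succ, hb, ha, Nat.add_sub_cancel,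
    Nat.add_sub_cancel, show (b + 1) * 2 - 1 = 2 * b + 1 by omega,
    show (a + 1) * 2 - 1 = 2 * a + 1 by omega]
  ring_nf
  omega

lemma exists_sub_zeta_pow_mul_mem {k m : ℕ}
    (h : ∀ n, m = n + 1 → ∀ d, socleDegree (k + 1) n < d → ∀ p ∈ steenrodGrading d,
      p ∈ zetaIdeal (k + 1) n (k + 1))
    {c : ℕ} (hc : socleDegree k m ≤ c) {p : DualSteenrod}
    (hp : p ∈ steenrodGrading (c + 2 ^ (k + 1) * (2 ^ m - 1))) :
    ∃ q ∈ steenrodGrading c, p - zeta m ^ 2 ^ (k + 1) * q ∈ zetaIdeal (k + 1) m k := by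
  cases m with
  | zero => exact ⟨p, by simpa using hp, by simp [zeta_zero]⟩
  | succ n =>
    refine (zetaIdeal_isHomogeneous _ _ _).exists_sub_pow_mul_mem steenrodGrading
      (zeta_mem_steenrodGrading (n + 1)) (fun d hd p hp => ?_)
      ((socleDegree_lt k n).trans_le (Nat.add_le_add_right hc _)) _ hp
    rw [span_zeta_sup_zetaIdeal]
    exact h n rfl d hd p hp

lemma zeta_pow_mul_mem_zetaIdeal {k m : ℕ} {q : DualSteenrod} (hq : q ∈ zetaIdeal k m k) :
    zeta m ^ 2 ^ (k + 1) * q ∈ zetaIdeal (k + 1) m (k + 1) := by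
  rw [← span_X_sup_zetaIdeal] at hq
  obtain ⟨y, l, hl, rfl⟩ := Ideal.mem_span_singleton_sup.1 hq
  rw [zetaIdeal_succ_succ]
  exact Ideal.mem_span_singleton_sup.2 ⟨y, zeta m ^ 2 ^ (k + 1) * l,
    Ideal.mul_mem_left _ _ hl, by ring⟩

lemma zetaIdeal_le_succ (k m j : ℕ) : zetaIdeal k m j ≤ zetaIdeal k m (j + 1) :=
  le_sup_right

/-- Every homogeneous element of degree greater than the socle degree lies in the ideal. -/
theorem mem_zetaIdeal_of_socleDegree_lt (k m : ℕ) :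
    ∀ d, socleDegree k m < d → ∀ p ∈ steenrodGrading d, p ∈ zetaIdeal k m k := by
  induction k generalizing m with
  | zero =>
    intro d hd p hp
    rw [zetaIdeal, Ideal.adjoinSeq, tailIdeal, mem_ideal_span_X_image]
    intro s hs
    by_contra! hzero
    have hs0 : s = 0 := Finsupp.ext fun i => hzero i i.zero_le
    have := hp (mem_support_iff.1 hs)
    rw [hs0, map_zero] at this
    omega
  | succ k ihk =>
    have step : ∀ m, (∀ n, m = n + 1 → ∀ d, socleDegree (k + 1) n < d →
        ∀ p ∈ steenrodGrading d, p ∈ zetaIdeal (k + 1) n (k + 1)) →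
        ∀ d, socleDegree (k + 1) m < d → ∀ p ∈ steenrodGrading d,
          p ∈ zetaIdeal (k + 1) m (k + 1) := by
      intro m h d hd p hp
      rw [socleDegree_succ] at hd
      obtain ⟨c, rfl⟩ := Nat.exists_eq_add_of_le' (le_of_add_le_right hd.le)
      have hc := lt_of_add_lt_add_right hd
      obtain ⟨q, hq, hpq⟩ := exists_sub_zeta_pow_mul_mem h hc.le hp
      have := Ideal.add_mem _ (zetaIdeal_le_succ _ _ _ hpq)
        (zeta_pow_mul_mem_zetaIdeal (ihk m c hc q hq))
      rwa [sub_add_cancel] at this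
    induction m with
    | zero => exact step 0 (by simp)
    | succ m ihm =>
      refine step (m + 1) fun n hn => ?_
      obtain rfl := Nat.succ_injective hn
      exact ihm

/-- The power of `ζ_m` generating the socle. -/
noncomputable def socleElement (k m : ℕ) : DualSteenrod := zeta m ^ (2 ^ (k + 1) - 2)

lemma socleElement_succ (k m : ℕ) :
    socleElement (k + 1) m = zeta m ^ 2 ^ (k + 1) * socleElement k m := by
  have : 2 ^ 1 ≤ 2 ^ (k + 1) := Nat.pow_le_pow_right two_pos (by omega)
  rw [socleElement, socleElement, ← pow_add, pow_succ 2 (k + 1)]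
  congr 1
  omega

lemma socleElement_mem_steenrodGrading (k m : ℕ) :
    socleElement k m ∈ steenrodGrading (socleDegree k m) := by
  have h : socleDegree k m = (2 ^ (k + 1) - 2) • (2 ^ m - 1) := by
    rw [socleDegree, smul_eq_mul, show 2 ^ (k + 1) - 2 = 2 * (2 ^ k - 1) by omega]
    ring
  rw [h]
  exact SetLike.pow_mem_graded _ (zeta_mem_steenrodGrading m)

theorem socleElement_notMem_zetaIdeal (k m : ℕ) : socleElement k m ∉ zetaIdeal k m k := by
  induction k with
  | zero =>
    rw [zetaIdeal, Ideal.adjoinSeq, tailIdeal, mem_ideal_span_X_image, socleElement]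
    intro h
    obtain ⟨i, -, hi⟩ := h 0 (by simp)
    simp at hi
  | succ k ih =>
    intro h
    rw [zetaIdeal_succ_succ, socleElement_succ] at h
    obtain ⟨y, l, hl, hy⟩ := Ideal.mem_span_singleton_sup.1 h
    refine ih ?_
    rw [← span_X_sup_zetaIdeal]
    refine Ideal.mem_span_singleton_sup.2 ⟨y, socleElement k m - y * X k, ?_, by ring⟩
    refine (zetaIdeal_isRegularMod_zeta k m).pow (2 ^ (k + 1)) _ ?_
    rwa [show zeta m ^ 2 ^ (k + 1) * (socleElement k m - y * X k) = l by
      linear_combination -hy]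

theorem exists_sub_smul_socleElement_mem (k m : ℕ) :
    ∀ p ∈ steenrodGrading (socleDegree k m),
      ∃ c : ZMod 2, p - c • socleElement k m ∈ zetaIdeal k m k := by
  induction k with
  | zero =>
    intro p _
    refine ⟨coeff 0 p, ?_⟩
    rw [zetaIdeal, Ideal.adjoinSeq, tailIdeal, mem_ideal_span_X_image]
    intro s hs
    by_contra! hzero
    have hs0 : s = 0 := Finsupp.ext fun i => hzero i i.zero_le
    rw [mem_support_iff, hs0] at hs
    simp [socleElement] at hs
  | succ k ih =>
    intro p hp
    rw [socleDegree_succ] at hp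
    obtain ⟨q, hq, hpq⟩ := exists_sub_zeta_pow_mul_mem
      (fun n _ => mem_zetaIdeal_of_socleDegree_lt (k + 1) n) le_rfl hp
    obtain ⟨c, hc⟩ := ih q hq
    refine ⟨c, ?_⟩
    have := Ideal.add_mem _ (zetaIdeal_le_succ _ _ _ hpq) (zeta_pow_mul_mem_zetaIdeal hc)
    rwa [mul_sub, mul_smul_comm, ← socleElement_succ, sub_add_sub_cancel] at this

end ZetaIdeal

section Truncation

/-- The section `A⟨k⟩ → A` of `proj k`. -/
noncomputable def inclusion (k : ℕ) : MvPolynomial (Fin k) (ZMod 2) →ₐ[ZMod 2] DualSteenrod :=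
  aeval fun i => X (i : ℕ)

lemma proj_inclusion (k : ℕ) (p : MvPolynomial (Fin k) (ZMod 2)) : proj k (inclusion k p) = p := by
  have : (proj k).comp (inclusion k) = AlgHom.id _ _ := by
    ext i
    simp [proj, inclusion]
  exact DFunLike.congr_fun this p

lemma inclusion_proj_sub_mem (k : ℕ) (p : DualSteenrod) :
    inclusion k (proj k p) - p ∈ tailIdeal k := by
  have : ((Ideal.Quotient.mkₐ (ZMod 2) (tailIdeal k)).comp (inclusion k)).comp (proj k) =
      Ideal.Quotient.mkₐ (ZMod 2) (tailIdeal k) := by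
    ext i
    by_cases h : i < k
    · simp [proj, inclusion, h]
    · simpa [proj, h] using
        (Ideal.Quotient.eq_zero_iff_mem.2 (X_mem_tailIdeal (not_lt.1 h))).symm
  exact Ideal.Quotient.eq.1 (DFunLike.congr_fun this p)

lemma proj_mem_span_zetaBar_iff (k m : ℕ) (p : DualSteenrod) :
    proj k p ∈ Ideal.span (Set.range fun i : Fin k => zetaBar k (m + 1 + (i : ℕ))) ↔
      p ∈ zetaIdeal k m k := by
  have hrange : (Set.range fun i : Fin k => zetaBar k (m + 1 + (i : ℕ))) =
      proj k '' ((fun i => zeta (m + 1 + i)) '' Set.Iio k) := by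
    ext x
    simp [zetaBar, Fin.exists_iff]
  rw [hrange, ← Ideal.map_span, zetaIdeal, Ideal.adjoinSeq_eq_sup_span]
  constructor
  · intro h
    obtain ⟨y, hy, hyp⟩ := (Ideal.mem_map_iff_of_surjective (proj k)
      fun p => ⟨_, proj_inclusion k p⟩).1 h
    have := Ideal.sub_mem _ (inclusion_proj_sub_mem k y) (inclusion_proj_sub_mem k p)
    rw [hyp, sub_sub_sub_cancel_left] at this
    have := Ideal.add_mem _ (Ideal.mem_sup_left this) (Ideal.mem_sup_right hy)
    rwa [sub_add_cancel] at this
  · intro h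
    obtain ⟨y, hy, z, hz, rfl⟩ := Submodule.mem_sup.1 h
    have hker : tailIdeal k ≤ RingHom.ker (proj k) := by
      refine Ideal.span_le.2 ?_
      rintro _ ⟨i, hi, rfl⟩
      simp [RingHom.mem_ker, proj, not_lt.2 (Set.mem_Ici.1 hi)]
    rw [map_add, (RingHom.mem_ker).1 (hker hy), zero_add]
    exact Ideal.mem_map_of_mem _ hz

lemma isWeightedHomogeneous_aeval {σ τ R M : Type*} [CommSemiring R] [AddCommMonoid M] {w : σ → M}
    {v : τ → M} {f : σ → MvPolynomial τ R} (hf : ∀ i, IsWeightedHomogeneous v (f i) (w i)) {d : M}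
    {p : MvPolynomial σ R} (hp : IsWeightedHomogeneous w p d) :
    IsWeightedHomogeneous v (aeval f p) d := by
  induction hp using IsWeightedHomogeneous.induction_on with
  | zero => rw [map_zero]; exact isWeightedHomogeneous_zero R v d
  | add p q _ _ hp hq => rw [map_add]; exact hp.add hq
  | monomial s r hs =>
    rw [aeval_monomial, algebraMap_eq]
    refine IsWeightedHomogeneous.C_mul ?_ r
    rw [← hs, Finsupp.weight_apply]
    exact IsWeightedHomogeneous.prod _ _ _ fun i _ => (hf i).pow (s i)

lemma inclusion_mem_steenrodGrading {k d : ℕ} {p : MvPolynomial (Fin k) (ZMod 2)}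
    (hp : IsWeightedHomogeneous (fun i : Fin k => 2 ^ ((i : ℕ) + 1) - 1) p d) :
    inclusion k p ∈ steenrodGrading d :=
  isWeightedHomogeneous_aeval (w := fun i : Fin k => 2 ^ ((i : ℕ) + 1) - 1)
    (fun i => isWeightedHomogeneous_X _ xiWeight (i : ℕ)) hp

lemma proj_isWeightedHomogeneous {k d : ℕ} {p : DualSteenrod} (hp : p ∈ steenrodGrading d) :
    IsWeightedHomogeneous (fun i : Fin k => 2 ^ ((i : ℕ) + 1) - 1) (proj k p) d := by
  refine isWeightedHomogeneous_aeval (fun i => ?_) hp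
  split_ifs with h
  · exact isWeightedHomogeneous_X _ _ _
  · exact isWeightedHomogeneous_zero _ _ _

end Truncation

/-- STATEMENT 9: With `δ = 2(2^m − 1)(2^k − 1)` and
`I = (ζ̄_{m+1}, …, ζ̄_{m+k}) ⊆ A⟨k⟩`: (1) every weighted-homogeneous polynomial
of weighted degree `> δ` lies in `I`; (2) the image in `A⟨k⟩/I` of the
weighted-homogeneous polynomials of degree `δ` is one-dimensional over `F₂`. -/
theorem quotient_zetaBar_socle (k m : ℕ) (hk : 1 ≤ k)
    (w : Fin k → ℕ) (hw : w = fun i : Fin k => 2 ^ ((i : ℕ) + 1) - 1)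
    (I : Ideal (MvPolynomial (Fin k) (ZMod 2)))
    (hI : I = Ideal.span (Set.range fun i : Fin k => zetaBar k (m + 1 + (i : ℕ))))
    (δ : ℕ) (hδ : δ = 2 * (2 ^ m - 1) * (2 ^ k - 1)) :
    (∀ (d : ℕ) (p : MvPolynomial (Fin k) (ZMod 2)),
        MvPolynomial.IsWeightedHomogeneous w p d → δ < d → p ∈ I) ∧
    Module.finrank (ZMod 2)
      ((MvPolynomial.weightedHomogeneousSubmodule (ZMod 2) w δ).map
        (Ideal.Quotient.mkₐ (ZMod 2) I).toLinearMap) = 1 := by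
  subst hw hI
  replace hδ : δ = socleDegree k m := hδ
  subst hδ
  have mem_iff (p : MvPolynomial (Fin k) (ZMod 2)) :
      p ∈ Ideal.span (Set.range fun i : Fin k => zetaBar k (m + 1 + (i : ℕ))) ↔
        inclusion k p ∈ zetaIdeal k m k := by
    rw [← proj_mem_span_zetaBar_iff, proj_inclusion]
  refine ⟨fun d p hp hd => (mem_iff p).2 ?_, ?_⟩
  · exact mem_zetaIdeal_of_socleDegree_lt k m d hd _ (inclusion_mem_steenrodGrading hp)
  · have hs : IsWeightedHomogeneous (fun i : Fin k => 2 ^ ((i : ℕ) + 1) - 1)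
        (proj k (socleElement k m)) (socleDegree k m) :=
      proj_isWeightedHomogeneous (socleElement_mem_steenrodGrading k m)
    refine finrank_eq_one_iff'.2 ⟨⟨_, Submodule.mem_map_of_mem hs⟩, fun h => ?_, ?_⟩
    · exact socleElement_notMem_zetaIdeal k m ((proj_mem_span_zetaBar_iff k m _).1
        (Ideal.Quotient.eq_zero_iff_mem.1 (congrArg Subtype.val h)))
    · rintro ⟨_, p, hp, rfl⟩
      obtain ⟨c, hc⟩ := exists_sub_smul_socleElement_mem k m (inclusion k p)
        (inclusion_mem_steenrodGrading hp)
      refine ⟨c, Subtype.ext ?_⟩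
      rw [← proj_mem_span_zetaBar_iff, map_sub, map_smul, proj_inclusion] at hc
      exact (Ideal.Quotient.eq.2 hc).symm
end
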